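/- (Core of Theorem 1.) Let a distributed computation carry a logical-clock assignment. Suppose there are checkpoints C_i^x and C_j^y with C_i^x ⇝ C_j^y and C_i^x.t ≥ C_j^y.t (so the timestamping is not Z-consistent), and suppose the computation contains a message m sent by P_j at or after C_j^y and received by P_i in interval I_i^x. Then C_j^y lies on a Z-cycle, and C_i^x does not causally precede C_j^y. -/

import Mathlib

/-- A distributed computation: `n ≥ 1` processes, each executing a sequence of
events indexed by positive integers; a type of messages with send/receive
processes and event indices; and for each process a (finite or infinite,
encoded by the domain predicate `hasCkpt`) strictly increasing sequence of
checkpoint event indices, starting at the index of the process's first event.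
Checkpoint events are neither send nor receive events. -/
structure DistComputation where
  /-- number of processes -/
  n : ℕ
  n_pos : 1 ≤ n
  /-- the messages of the computation -/
  Msg : Type
  /-- sending process of a message -/
  snd : Msg → Fin n
  /-- index of the send event of a message -/
  sendIdx : Msg → ℕ
  /-- receiving process of a message -/
  rcv : Msg → Fin n
  /-- index of the receive event of a message -/
  recvIdx : Msg → ℕ
  /-- event indices are positive -/
  sendIdx_pos : ∀ m, 1 ≤ sendIdx m
  recvIdx_pos : ∀ m, 1 ≤ recvIdx m
  /-- `hasCkpt i x`: process `i` has an `x`-th checkpoint (`x` counted from 1) -/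
  hasCkpt : Fin n → ℕ → Prop
  /-- `ckptIdx i x`: the event index of the `x`-th checkpoint `C_i^x` of process `i` -/
  ckptIdx : Fin n → ℕ → ℕ
  /-- every process has a first checkpoint -/
  hasCkpt_one : ∀ i, hasCkpt i 1
  /-- the checkpoints of a process form an initial segment -/
  hasCkpt_of_succ : ∀ i x, hasCkpt i (x + 1) → hasCkpt i x
  /-- the sequence of checkpoint indices is strictly increasing -/
  ckptIdx_strictMono : ∀ i x y, hasCkpt i x → hasCkpt i y → x < y → ckptIdx i x < ckptIdx i y
  /-- the first checkpoint is the first event of the process -/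
  ckptIdx_one : ∀ i, ckptIdx i 1 = 1
  /-- checkpoint events are not send events -/
  ckpt_ne_send : ∀ i x m, hasCkpt i x → snd m = i → sendIdx m ≠ ckptIdx i x
  /-- checkpoint events are not receive events -/
  ckpt_ne_recv : ∀ i x m, hasCkpt i x → rcv m = i → recvIdx m ≠ ckptIdx i x

/-- An event: a process together with an event index. -/
abbrev DistComputation.Event (D : DistComputation) := Fin D.n × ℕ

/-- Causal precedence `e → e'`: the smallest transitive relation such that each
event precedes the next event of the same process and the send event of every
message precedes its receive event. -/
inductive DistComputation.Precedes (D : DistComputation) : D.Event → D.Event → Prop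
  | step (i : Fin D.n) (x : ℕ) : DistComputation.Precedes D (i, x) (i, x + 1)
  | msg (m : D.Msg) :
      DistComputation.Precedes D (D.snd m, D.sendIdx m) (D.rcv m, D.recvIdx m)
  | trans {e e' e'' : D.Event} : DistComputation.Precedes D e e' →
      DistComputation.Precedes D e' e'' → DistComputation.Precedes D e e''

/-- The event of process `k` with index `e` lies in the checkpoint interval
`I_k^w`: at or after `C_k^w` and, if `C_k^{w+1}` exists, strictly before it. -/
def DistComputation.InInterval (D : DistComputation) (k : Fin D.n) (w : ℕ) (e : ℕ) : Prop :=
  D.hasCkpt k w ∧ D.ckptIdx k w ≤ e ∧ (D.hasCkpt k (w + 1) → e < D.ckptIdx k (w + 1))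

/-- `ms = [m_1, …, m_q]` is a zigzag path from checkpoint `C_i^x` to
checkpoint `C_j^y`. -/
def DistComputation.IsZigzagPath (D : DistComputation) (ms : List D.Msg)
    (i : Fin D.n) (x : ℕ) (j : Fin D.n) (y : ℕ) : Prop :=
  ms ≠ [] ∧ D.hasCkpt i x ∧ D.hasCkpt j y ∧
  -- `m_1` is sent by `P_i` at or after `C_i^x`
  (∀ m₁ ∈ ms.head?, D.snd m₁ = i ∧ D.ckptIdx i x ≤ D.sendIdx m₁) ∧
  -- each `m_z` is received by the process sending `m_{z+1}`, and if `m_z` is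
  -- received in interval `I_k^w` then `m_{z+1}` is sent in an interval
  -- `I_k^{w'}` with `w' ≥ w`
  (∀ z : ℕ, ∀ hz : z + 1 < ms.length,
    D.rcv (ms[z]'(Nat.lt_of_succ_lt hz)) = D.snd (ms[z + 1]'hz) ∧
    ∀ w : ℕ, D.InInterval (D.rcv (ms[z]'(Nat.lt_of_succ_lt hz))) w
        (D.recvIdx (ms[z]'(Nat.lt_of_succ_lt hz))) →
      ∃ w' : ℕ, w ≤ w' ∧
        D.InInterval (D.rcv (ms[z]'(Nat.lt_of_succ_lt hz))) w'
          (D.sendIdx (ms[z + 1]'hz))) ∧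
  -- `m_q` is received by `P_j` strictly before `C_j^y`
  (∀ mq ∈ ms.getLast?, D.rcv mq = j ∧ D.recvIdx mq < D.ckptIdx j y)

/-- `C_i^x ⇝ C_j^y`: there is a zigzag path from `C_i^x` to `C_j^y`. -/
def DistComputation.ZigzagTo (D : DistComputation)
    (i : Fin D.n) (x : ℕ) (j : Fin D.n) (y : ℕ) : Prop :=
  ∃ ms : List D.Msg, D.IsZigzagPath ms i x j y

/-- A zigzag path is causal if the send event of each `m_{z+1}` has index at
least the index of the receive event of `m_z` in their common process. -/
def DistComputation.IsCausal (D : DistComputation) (ms : List D.Msg) : Prop :=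
  ∀ z : ℕ, ∀ hz : z + 1 < ms.length,
    D.recvIdx (ms[z]'(Nat.lt_of_succ_lt hz)) ≤ D.sendIdx (ms[z + 1]'hz)

/-- A logical-clock assignment on a distributed computation: an integer clock
`lc` on events, nondecreasing along each process, strictly increasing at each
checkpoint event having a predecessor; message timestamps equal to the clock
of the send event; and the clock at a receive event at least the message's
timestamp. -/
structure LogicalClock (D : DistComputation) where
  /-- the logical clock of each event -/
  lc : D.Event → ℤ
  /-- the timestamp `m.t` of each message -/
  mt : D.Msg → ℤ
  /-- the clock is nondecreasing along each process's event sequence -/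
  lc_mono : ∀ (i : Fin D.n) (x y : ℕ), x ≤ y → lc (i, x) ≤ lc (i, y)
  /-- the clock strictly increases at a checkpoint event that has an
  immediately preceding event of the same process -/
  lc_ckpt : ∀ (i : Fin D.n) (x : ℕ), D.hasCkpt i x → 2 ≤ D.ckptIdx i x →
      lc (i, D.ckptIdx i x - 1) < lc (i, D.ckptIdx i x)
  /-- `m.t` is the clock of the send event of `m` -/
  mt_send : ∀ m, mt m = lc (D.snd m, D.sendIdx m)
  /-- the clock at the receive event of `m` is at least `m.t` -/
  mt_recv : ∀ m, mt m ≤ lc (D.rcv m, D.recvIdx m)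

/-- The timestamp `C_i^x.t` of checkpoint `C_i^x` under a logical-clock
assignment: the clock of the checkpoint event. -/
def LogicalClock.ckptT {D : DistComputation} (L : LogicalClock D)
    (i : Fin D.n) (x : ℕ) : ℤ :=
  L.lc (i, D.ckptIdx i x)

theorem DistComputation.hasCkpt_of_le (D : DistComputation) {k : Fin D.n} {v w : ℕ}
    (h : v ≤ w) (hw : D.hasCkpt k w) : D.hasCkpt k v := by
  induction w, h using Nat.le_induction with
  | base => exact hw
  | succ w _ ih => exact ih (D.hasCkpt_of_succ k w hw)

theorem DistComputation.ckptIdx_mono (D : DistComputation) {k : Fin D.n} {v w : ℕ}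
    (h : v ≤ w) (hw : D.hasCkpt k w) : D.ckptIdx k v ≤ D.ckptIdx k w := by
  rcases h.eq_or_lt with rfl | h
  · exact le_rfl
  · exact (D.ckptIdx_strictMono k v w (D.hasCkpt_of_le h.le hw) hw h).le

theorem DistComputation.le_ckptIdx (D : DistComputation) {k : Fin D.n} {w : ℕ}
    (hw : D.hasCkpt k w) : w ≤ D.ckptIdx k w := by
  induction w with
  | zero => exact Nat.zero_le _
  | succ w ih =>
    have hw' := D.hasCkpt_of_succ k w hw
    have := D.ckptIdx_strictMono k w (w + 1) hw' hw w.lt_succ_self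
    have := ih hw'
    omega

/-- The checkpoint interval containing an event is the last one starting no later. -/
theorem DistComputation.InInterval.le_of_ckptIdx_le {D : DistComputation} {k : Fin D.n}
    {v w e : ℕ} (h : D.InInterval k w e) (hv : D.hasCkpt k v) (hve : D.ckptIdx k v ≤ e) :
    v ≤ w := by
  by_contra! hlt
  have := h.2.2 (D.hasCkpt_of_le hlt hv)
  have := D.ckptIdx_mono (Nat.succ_le_of_lt hlt) hv
  simp only [Nat.succ_eq_add_one] at this
  omega

/-- An event at or after a checkpoint lies in the interval of that checkpoint or a later one. -/
theorem DistComputation.exists_inInterval (D : DistComputation) {k : Fin D.n} {v e : ℕ}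
    (hv : D.hasCkpt k v) (hve : D.ckptIdx k v ≤ e) : ∃ w, v ≤ w ∧ D.InInterval k w e := by
  classical
  let p : ℕ → Prop := fun w => D.hasCkpt k w ∧ D.ckptIdx k w ≤ e
  have hvb : v ≤ e := (D.le_ckptIdx hv).trans hve
  have hp : p (Nat.findGreatest p e) := Nat.findGreatest_spec hvb ⟨hv, hve⟩
  refine ⟨Nat.findGreatest p e, Nat.le_findGreatest hvb ⟨hv, hve⟩, hp.1, hp.2, fun hs => ?_⟩
  by_contra! hle
  exact absurd (Nat.le_findGreatest (P := p) ((D.le_ckptIdx hs).trans hle) ⟨hs, hle⟩)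
    (Nat.not_succ_le_self _)

/-- A message sent at or after `C_j^y` and received in `I_i^x` extends every zigzag path
from `C_i^x` to one from `C_j^y`. -/
theorem DistComputation.ZigzagTo.cons {D : DistComputation} {i j k : Fin D.n} {x y z : ℕ}
    (h : D.ZigzagTo i x k z) (hy : D.hasCkpt j y) {m : D.Msg} (hsnd : D.snd m = j)
    (hsend : D.ckptIdx j y ≤ D.sendIdx m) (hrcv : D.rcv m = i)
    (hin : D.InInterval i x (D.recvIdx m)) : D.ZigzagTo j y k z := by
  obtain ⟨ms, hne, hx, hz, hhead, hlink, hlast⟩ := h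
  obtain ⟨m₁, ms, rfl⟩ := List.exists_cons_of_ne_nil hne
  obtain ⟨hsnd₁, hsend₁⟩ := hhead m₁ rfl
  refine ⟨m :: m₁ :: ms, List.cons_ne_nil _ _, hy, hz, ?_, ?_, ?_⟩
  · rintro _ ⟨⟩
    exact ⟨hsnd, hsend⟩
  · rintro (_ | q) hq
    · refine ⟨hrcv.trans hsnd₁.symm, fun w hw => ?_⟩
      simp only [List.getElem_cons_zero, List.getElem_cons_succ, hrcv] at hw ⊢
      obtain ⟨w', hw', hin'⟩ := D.exists_inInterval hx hsend₁
      exact ⟨w', (hin.le_of_ckptIdx_le hw.1 hw.2.1).trans hw', hin'⟩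
    · exact hlink q (Nat.lt_of_succ_lt_succ hq)
  · simpa using hlast

theorem DistComputation.ZigzagTo.two_le_ckptIdx {D : DistComputation} {i j : Fin D.n}
    {x y : ℕ} (h : D.ZigzagTo i x j y) : 2 ≤ D.ckptIdx j y := by
  obtain ⟨ms, hne, -, -, -, -, hlast⟩ := h
  have := (hlast _ (List.getLast?_eq_some_getLast hne)).2
  have := D.recvIdx_pos (ms.getLast hne)
  omega

theorem LogicalClock.lc_le_of_precedes {D : DistComputation} (L : LogicalClock D)
    {e e' : D.Event} (h : D.Precedes e e') : L.lc e ≤ L.lc e' := by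
  induction h with
  | step k a => exact L.lc_mono k a (a + 1) a.le_succ
  | msg m => exact (L.mt_send m).symm.le.trans (L.mt_recv m)
  | trans _ _ h₁ h₂ => exact h₁.trans h₂

/-- Causality reaches a checkpoint only through the preceding event of its process. -/
theorem LogicalClock.lc_le_pred_of_precedes {D : DistComputation} (L : LogicalClock D)
    {e e' : D.Event} (h : D.Precedes e e') {y : ℕ} (hy : D.hasCkpt e'.1 y)
    (he' : e'.2 = D.ckptIdx e'.1 y) : L.lc e ≤ L.lc (e'.1, e'.2 - 1) := by
  induction h with
  | step k a => simp
  | msg m => exact absurd he' (D.ckpt_ne_recv _ _ m hy rfl)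
  | trans h₁ _ _ ih => exact (L.lc_le_of_precedes h₁).trans (ih hy he')

/-- core of Theorem 1: Under a logical-clock assignment, if
`C_i^x ⇝ C_j^y` with `C_i^x.t ≥ C_j^y.t`, and the computation contains a
message `m` sent by `P_j` at or after `C_j^y` and received by `P_i` in
interval `I_i^x`, then `C_j^y` lies on a Z-cycle and `C_i^x` does not causally
precede `C_j^y`. -/
theorem useless_ckpt_of_non_zconsistent (D : DistComputation)
    (L : LogicalClock D)
    (i : Fin D.n) (x : ℕ) (j : Fin D.n) (y : ℕ)
    (hx : D.hasCkpt i x) (hy : D.hasCkpt j y)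
    (hzz : D.ZigzagTo i x j y) (ht : L.ckptT j y ≤ L.ckptT i x)
    (m : D.Msg) (hsnd : D.snd m = j) (hsend : D.ckptIdx j y ≤ D.sendIdx m)
    (hrcv : D.rcv m = i) (hin : D.InInterval i x (D.recvIdx m)) :
    D.ZigzagTo j y j y ∧
      ¬ D.Precedes (i, D.ckptIdx i x) (j, D.ckptIdx j y) := by
  refine ⟨hzz.cons hy hsnd hsend hrcv hin, fun hprec => ?_⟩
  have hle := L.lc_le_pred_of_precedes hprec hy rfl
  exact absurd (hle.trans_lt (L.lc_ckpt j y hy hzz.two_le_ckptIdx)) (not_lt.mpr ht)
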